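/- arXiv:2105.14365 — 2 statements merged into one kernel-verified Lean document; each statement's English description precedes it below -/
import Mathlib

section
/- Let G be a finite group of order 240 having exactly one element of order 2 and possessing a normal subgroup N isomorphic to SL(2,5) (these conditions characterize the non-split extension SL(2,5).C_2). Then G possesses a free real representation of dimension 8; that is, there exists a representation ρ of G on an 8-dimensional real vector space such that for every non-identity element g of G, the element ρ(g) fixes no nonzero vector. -/
/-- Octuples of integers, standing for quaternions over `ℤ[√5]`. -/
structure Oct where
  a : ℤ
  av : ℤ
  b : ℤ
  bv : ℤ
  c : ℤ
  cv : ℤ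
  d : ℤ
  dv : ℤ

instance : DecidableEq Oct := fun p q =>
  decidable_of_iff (p.a = q.a ∧ p.av = q.av ∧ p.b = q.b ∧ p.bv = q.bv ∧
      p.c = q.c ∧ p.cv = q.cv ∧ p.d = q.d ∧ p.dv = q.dv) (by
    cases p; cases q; simp)

namespace Oct

/-- Quaternion product. -/
def mul (p q : Oct) : Oct :=
  ⟨p.a*q.a + 5*(p.av*q.av) - (p.b*q.b + 5*(p.bv*q.bv)) - (p.c*q.c + 5*(p.cv*q.cv))
      - (p.d*q.d + 5*(p.dv*q.dv)),
   p.a*q.av + p.av*q.a - (p.b*q.bv + p.bv*q.b) - (p.c*q.cv + p.cv*q.c) - (p.d*q.dv + p.dv*q.d),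
   p.a*q.b + 5*(p.av*q.bv) + (p.b*q.a + 5*(p.bv*q.av)) + (p.c*q.d + 5*(p.cv*q.dv))
      - (p.d*q.c + 5*(p.dv*q.cv)),
   p.a*q.bv + p.av*q.b + (p.b*q.av + p.bv*q.a) + (p.c*q.dv + p.cv*q.d) - (p.d*q.cv + p.dv*q.c),
   p.a*q.c + 5*(p.av*q.cv) - (p.b*q.d + 5*(p.bv*q.dv)) + (p.c*q.a + 5*(p.cv*q.av))
      + (p.d*q.b + 5*(p.dv*q.bv)),
   p.a*q.cv + p.av*q.c - (p.b*q.dv + p.bv*q.d) + (p.c*q.av + p.cv*q.a) + (p.d*q.bv + p.dv*q.b),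
   p.a*q.d + 5*(p.av*q.dv) + (p.b*q.c + 5*(p.bv*q.cv)) - (p.c*q.b + 5*(p.cv*q.bv))
      + (p.d*q.a + 5*(p.dv*q.av)),
   p.a*q.dv + p.av*q.d + (p.b*q.cv + p.bv*q.c) - (p.c*q.bv + p.cv*q.b) + (p.d*q.av + p.dv*q.a)⟩

/-- Division by four. -/
def quarter (p : Oct) : Oct :=
  ⟨p.a/4, p.av/4, p.b/4, p.bv/4, p.c/4, p.cv/4, p.d/4, p.dv/4⟩

/-- Multiplication by four. -/
def four (p : Oct) : Oct :=
  ⟨4*p.a, 4*p.av, 4*p.b, 4*p.bv, 4*p.c, 4*p.cv, 4*p.d, 4*p.dv⟩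

/-- Normalised product. -/
def nm (p q : Oct) : Oct := (mul p q).quarter

/-- Normalised power. -/
def pw (p : Oct) : ℕ → Oct
  | 0 => ⟨4,0,0,0,0,0,0,0⟩
  | n+1 => nm p (pw p n)

/-- Image of `[[1,1],[0,1]]`. -/
def U : Oct := ⟨-1,1,0,0,-1,-1,2,0⟩
/-- Image of `[[1,0],[1,1]]`. -/
def L : Oct := ⟨-1,1,0,0,-1,-1,-2,0⟩

/-- Image of a matrix with nonzero lower left entry. -/
def F0 (a c d : ZMod 5) : Oct :=
  nm (pw U ((a-1)*(c*c*c)).val) (nm (pw L c.val) (pw U ((d-1)*(c*c*c)).val))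

/-- Four times the image of a matrix of determinant one. -/
def F (a b c d : ZMod 5) : Oct :=
  if c = 0 then nm (pw L 4) (F0 a (a+c) (b+d)) else F0 a c d

set_option maxRecDepth 100000 in
theorem F_U : ∀ x a b c d : ZMod 5, a*d-b*c = 1 →
    four (F (a+x*c) (b+x*d) c d) = mul (F 1 x 0 1) (F a b c d) := by
  decide +kernel

set_option maxRecDepth 100000 in
theorem F_L : ∀ x a b c d : ZMod 5, a*d-b*c = 1 →
    four (F a b (x*a+c) (x*b+d)) = mul (F 1 0 x 1) (F a b c d) := by
  decide +kernel

set_option maxRecDepth 100000 in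
theorem F_one : F 1 0 0 1 = ⟨4,0,0,0,0,0,0,0⟩ := by
  decide +kernel

set_option maxRecDepth 100000 in
theorem F_ne : ∀ a b c d : ZMod 5, a*d-b*c = 1 → ¬ (a = 1 ∧ b = 0 ∧ c = 0 ∧ d = 1) →
    ((F a b c d).a - 4)^2 ≠ 5 * (F a b c d).av^2 := by
  decide +kernel

/-- The real quaternion attached to an octuple. -/
noncomputable def toH (p : Oct) : Quaternion ℝ :=
  ⟨p.a + p.av * √5, p.b + p.bv * √5, p.c + p.cv * √5, p.d + p.dv * √5⟩

@[simp] theorem toH_re (p : Oct) : (toH p).re = p.a + p.av * √5 := rfl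
@[simp] theorem toH_imI (p : Oct) : (toH p).imI = p.b + p.bv * √5 := rfl
@[simp] theorem toH_imJ (p : Oct) : (toH p).imJ = p.c + p.cv * √5 := rfl
@[simp] theorem toH_imK (p : Oct) : (toH p).imK = p.d + p.dv * √5 := rfl

theorem toH_mul (p q : Oct) : toH (mul p q) = toH p * toH q := by
  have h : (√5:ℝ)^2 = 5 := Real.sq_sqrt (by norm_num)
  ext <;> simp [mul] <;> ring_nf <;> rw [h] <;> ring

theorem toH_four (p : Oct) : toH (four p) = (4:ℝ) • toH p := by
  ext <;> simp [four] <;> ring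

end Oct

open Oct

abbrev SL25 := Matrix.SpecialLinearGroup (Fin 2) (ZMod 5)

/-- The embedding of `SL(2,5)` in the quaternions. -/
noncomputable def ff (g : SL25) : Quaternion ℝ :=
  (1/4 : ℝ) • toH (F (g.1 0 0) (g.1 0 1) (g.1 1 0) (g.1 1 1))

def uu (x : ZMod 5) : SL25 := ⟨!![1, x; 0, 1], by simp⟩
def ll (x : ZMod 5) : SL25 := ⟨!![1, 0; x, 1], by simp⟩

@[simp] theorem uu00 (x : ZMod 5) : (uu x).1 0 0 = 1 := rfl
@[simp] theorem uu01 (x : ZMod 5) : (uu x).1 0 1 = x := rfl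
@[simp] theorem uu10 (x : ZMod 5) : (uu x).1 1 0 = 0 := rfl
@[simp] theorem uu11 (x : ZMod 5) : (uu x).1 1 1 = 1 := rfl
@[simp] theorem ll00 (x : ZMod 5) : (ll x).1 0 0 = 1 := rfl
@[simp] theorem ll01 (x : ZMod 5) : (ll x).1 0 1 = 0 := rfl
@[simp] theorem ll10 (x : ZMod 5) : (ll x).1 1 0 = x := rfl
@[simp] theorem ll11 (x : ZMod 5) : (ll x).1 1 1 = 1 := rfl

theorem sl_mul (g h : SL25) (i j : Fin 2) :
    (g * h).1 i j = g.1 i 0 * h.1 0 j + g.1 i 1 * h.1 1 j := by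
  rw [show (g * h).1 = g.1 * h.1 from rfl, Matrix.mul_apply, Fin.sum_univ_two]

theorem sl_ext (g h : SL25) (h00 : g.1 0 0 = h.1 0 0) (h01 : g.1 0 1 = h.1 0 1)
    (h10 : g.1 1 0 = h.1 1 0) (h11 : g.1 1 1 = h.1 1 1) : g = h := by
  apply Subtype.ext
  ext i j
  fin_cases i <;> fin_cases j <;> assumption

theorem sl_card : Nat.card SL25 = 120 := by
  let e : SL25 ≃ {p : ZMod 5 × ZMod 5 × ZMod 5 × ZMod 5 //
      p.1 * p.2.2.2 - p.2.1 * p.2.2.1 = 1} :=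
    { toFun := fun g => ⟨(g.1 0 0, g.1 0 1, g.1 1 0, g.1 1 1), by
        have := g.2
        rwa [Matrix.det_fin_two] at this⟩
      invFun := fun p => ⟨!![p.1.1, p.1.2.1; p.1.2.2.1, p.1.2.2.2], by
        rw [Matrix.det_fin_two]; exact p.2⟩
      left_inv := fun g => sl_ext _ _ rfl rfl rfl rfl
      right_inv := fun p => rfl }
  rw [Nat.card_congr e, Nat.card_eq_fintype_card]
  decide +kernel

theorem det_eq (g : SL25) : g.1 0 0 * g.1 1 1 - g.1 0 1 * g.1 1 0 = 1 := by
  have := g.2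
  rwa [Matrix.det_fin_two] at this

theorem smul_aux (p q r : Oct) (h : four p = mul q r) :
    (1/4 : ℝ) • toH p = ((1/4 : ℝ) • toH q) * ((1/4 : ℝ) • toH r) := by
  have h2 : (4:ℝ) • toH p = toH q * toH r := by rw [← toH_four, h, toH_mul]
  rw [smul_mul_smul_comm, ← h2, smul_smul]
  norm_num

theorem ff_uu (x : ZMod 5) (g : SL25) : ff (uu x * g) = ff (uu x) * ff g := by
  have := smul_aux _ _ _ (F_U x _ _ _ _ (det_eq g))
  simpa only [ff, sl_mul, uu00, uu01, uu10, uu11, ll00, ll01, ll10, ll11, zero_mul, one_mul,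
    zero_add, add_zero] using this

theorem ff_ll (x : ZMod 5) (g : SL25) : ff (ll x * g) = ff (ll x) * ff g := by
  have := smul_aux _ _ _ (F_L x _ _ _ _ (det_eq g))
  simpa only [ff, sl_mul, uu00, uu01, uu10, uu11, ll00, ll01, ll10, ll11, zero_mul, one_mul,
    zero_add, add_zero] using this

theorem ff_one : ff 1 = 1 := by
  have : ff 1 = (1/4 : ℝ) • toH (F 1 0 0 1) := by simp [ff]
  rw [this, F_one]
  have h1 : toH ⟨4,0,0,0,0,0,0,0⟩ = (4:ℝ) • (1 : Quaternion ℝ) := by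
    ext <;> simp [Quaternion.re_one, Quaternion.imI_one, Quaternion.imJ_one, Quaternion.imK_one]
  rw [h1, smul_smul]
  norm_num

instance : Fact (Nat.Prime 5) := ⟨by norm_num⟩

theorem dec0 (g : SL25) (hc : g.1 1 0 ≠ 0) : ∃ x y z, g = uu x * (ll y * uu z) := by
  have hd := det_eq g
  refine ⟨(g.1 0 0 - 1) / g.1 1 0, g.1 1 0, (g.1 1 1 - 1) / g.1 1 0, ?_⟩
  apply sl_ext <;> simp only [sl_mul, uu00, uu01, uu10, uu11, ll00, ll01, ll10, ll11] <;>
    field_simp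
  · ring
  · linear_combination (-1) * hd
  · ring
  · ring

theorem dec1 (g : SL25) : ∃ w x y z, g = ll w * (uu x * (ll y * uu z)) := by
  by_cases hc : g.1 1 0 = 0
  · have hd := det_eq g
    have ha : g.1 0 0 ≠ 0 := by
      intro h; rw [h, hc] at hd; simp at hd
    obtain ⟨x, y, z, h⟩ := dec0 (ll 1 * g) (by
      simpa only [sl_mul, ll10, ll11, hc, one_mul, add_zero] using ha)
    refine ⟨-1, x, y, z, ?_⟩
    rw [← h, ← mul_assoc]
    have : ll (-1) * ll 1 = 1 := by
      apply sl_ext <;> decide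
    rw [this, one_mul]
  · obtain ⟨x, y, z, h⟩ := dec0 g hc
    refine ⟨0, x, y, z, ?_⟩
    have : ll 0 = 1 := by
      apply sl_ext <;> decide
    rw [this, one_mul, ← h]

theorem ff_mul (g h : SL25) : ff (g * h) = ff g * ff h := by
  obtain ⟨w, x, y, z, rfl⟩ := dec1 g
  simp only [mul_assoc, ff_ll, ff_uu]

theorem ff_ne (g : SL25) (hg : g ≠ 1) : ff g ≠ 1 := by
  intro h
  have hn : ¬ (g.1 0 0 = 1 ∧ g.1 0 1 = 0 ∧ g.1 1 0 = 0 ∧ g.1 1 1 = 1) := by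
    rintro ⟨h1, h2, h3, h4⟩
    exact hg (sl_ext _ _ h1 h2 h3 h4)
  apply F_ne _ _ _ _ (det_eq g) hn
  have h1 := congrArg QuaternionAlgebra.re h
  rw [Quaternion.re_one] at h1
  simp only [ff] at h1
  generalize F (g.1 0 0) (g.1 0 1) (g.1 1 0) (g.1 1 1) = p at h1 ⊢
  have h2 : (1/4:ℝ) * (p.a + p.av * √5) = 1 := by simpa using h1
  have h5 : (√5:ℝ)^2 = 5 := Real.sq_sqrt (by norm_num)
  have h3 : ((p.a:ℝ) - 4) = - (p.av * √5) := by linarith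
  have h4 : ((p.a:ℝ) - 4)^2 = 5 * p.av^2 := by rw [h3, neg_sq, mul_pow, h5]; ring
  exact_mod_cast h4

/-- The resulting representation. -/
noncomputable def rr : Representation ℝ SL25 (Quaternion ℝ) where
  toFun g := LinearMap.mulLeft ℝ (ff g)
  map_one' := by rw [ff_one]; ext1 x; simp
  map_mul' g h := by rw [ff_mul]; ext1 x; simp [mul_assoc]

theorem rr_free (g : SL25) (hg : g ≠ 1) (v : Quaternion ℝ) (h : rr g v = v) : v = 0 := by
  by_contra hv
  have hgv : ff g * v = v := h
  exact ff_ne g hg (mul_right_cancel₀ hv (by rw [hgv, one_mul]))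

theorem stmt13 {G : Type*} [Group G] [Finite G]
    (hcard : Nat.card G = 240)
    (huniq : ∃! g : G, orderOf g = 2)
    (N : Subgroup G) (hN : N.Normal)
    (hiso : Nonempty (N ≃* Matrix.SpecialLinearGroup (Fin 2) (ZMod 5))) :
    ∃ ρ : Representation ℝ G (Fin 8 → ℝ),
      ∀ g : G, g ≠ 1 → ∀ v : Fin 8 → ℝ, ρ g v = v → v = 0 := by
  classical
  obtain ⟨e⟩ := hiso
  let σ : Representation ℝ N (Quaternion ℝ) := rr.comp e.toMonoidHom
  have σfree : ∀ n : N, n ≠ 1 → ∀ v, σ n v = v → v = 0 := fun n hn v h =>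
    rr_free (e n) (by simpa using hn) v h
  -- an involution in N
  have hinv : ∃ n : N, orderOf n = 2 := by
    let z : SL25 := ⟨!![-1, 0; 0, -1], by simp⟩
    refine ⟨e.symm z, ?_⟩
    rw [MulEquiv.orderOf_eq]
    apply orderOf_eq_prime
    · rw [pow_two]
      apply sl_ext <;> decide
    · intro h
      have := congrArg (fun m : SL25 => m.1 0 0) h
      simp [z] at this
      revert this
      decide
  obtain ⟨n0, hn0⟩ := hinv
  have hind : N.index = 2 := by
    have hNc : Nat.card N = 120 := by
      rw [Nat.card_congr e.toEquiv, sl_card]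
    have := N.card_mul_index
    rw [hNc, hcard] at this
    omega
  obtain ⟨t, ht⟩ : ∃ t, t ∉ N := by
    by_contra! h
    have : N = ⊤ := by ext x; simp [h x]
    rw [this] at hind
    simp at hind
  let W := Representation.coindV N.subtype σ
  let τ : Representation ℝ G W := Representation.coind N.subtype σ
  have hτ : ∀ (g : G) (φ : W) (x : G), (τ g φ).1 x = φ.1 (x * g) := fun _ _ _ => rfl
  have hW : ∀ (φ : W) (n : N) (x : G), φ.1 (n * x) = σ n (φ.1 x) := fun φ n x => φ.2 n x
  have free1 : ∀ g ∈ N, g ≠ 1 → ∀ φ : W, τ g φ = φ → φ = 0 := by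
    intro g hg hg1 φ h
    apply Subtype.ext
    funext x
    have h1 : φ.1 (x * g) = φ.1 x := by rw [← hτ, h]
    have h2 := hW φ ⟨x * g * x⁻¹, hN.conj_mem g hg x⟩ x
    simp only [inv_mul_cancel_right] at h2
    rw [h1] at h2
    refine σfree _ ?_ _ h2.symm
    intro h3
    have h4 := congrArg Subtype.val h3
    simp at h4
    exact hg1 h4
  have free : ∀ g, g ≠ 1 → ∀ φ : W, τ g φ = φ → φ = 0 := by
    intro g hg1 φ h
    by_cases hg : g ∈ N
    · exact free1 g hg hg1 φ h
    · refine free1 (g * g) ?_ ?_ φ ?_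
      · exact Subgroup.mul_self_mem_of_index_two hind g
      · intro h2
        have : orderOf g = 2 := orderOf_eq_prime (by rw [pow_two, h2]) hg1
        have h3 := huniq.unique this (y₂ := (n0 : G)) (by rw [Subgroup.orderOf_coe, hn0])
        exact hg (h3 ▸ n0.2)
      · rw [map_mul, Module.End.mul_apply, h, h]
  have hmem : ∀ x, x ∉ N → x * t⁻¹ ∈ N := by
    intro x hx
    rw [Subgroup.mul_mem_iff_of_index_two hind]
    simp [hx, ht]
  let ev : W →ₗ[ℝ] (Quaternion ℝ × Quaternion ℝ) :=
    { toFun := fun φ => (φ.1 1, φ.1 t)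
      map_add' := fun _ _ => rfl
      map_smul' := fun _ _ => rfl }
  have evb : Function.Bijective ev := by
    constructor
    · rw [← LinearMap.ker_eq_bot, LinearMap.ker_eq_bot']
      intro φ h
      have h1 : φ.1 1 = 0 := congrArg Prod.fst h
      have h2 : φ.1 t = 0 := congrArg Prod.snd h
      apply Subtype.ext
      funext x
      by_cases hx : x ∈ N
      · have := hW φ ⟨x, hx⟩ 1
        simpa [h1] using this
      · have := hW φ ⟨x * t⁻¹, hmem x hx⟩ t
        simpa [h2] using this
    · rintro ⟨a, b⟩
      let φ : G → Quaternion ℝ := fun x =>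
        if hx : x ∈ N then σ ⟨x, hx⟩ a else σ ⟨x * t⁻¹, hmem x hx⟩ b
      have hφ : φ ∈ Representation.coindV N.subtype σ := by
        intro n x
        by_cases hx : x ∈ N
        · have hx' : (n : G) * x ∈ N := N.mul_mem n.2 hx
          simp only [φ, Subgroup.subtype_apply, dif_pos hx, dif_pos hx']
          rw [← Module.End.mul_apply, ← map_mul]
          rfl
        · have hx' : (n : G) * x ∉ N := by rwa [N.mul_mem_cancel_left n.2]
          simp only [φ, Subgroup.subtype_apply, dif_neg hx, dif_neg hx']
          rw [← Module.End.mul_apply, ← map_mul]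
          congr 2
          apply Subtype.ext
          simp [mul_assoc]
      refine ⟨⟨φ, hφ⟩, ?_⟩
      have e1 : φ 1 = a := by
        have : (⟨1, N.one_mem⟩ : N) = 1 := rfl
        simp only [φ, dif_pos N.one_mem, this, map_one, Module.End.one_apply]
      have e2 : φ t = b := by
        have : (⟨t * t⁻¹, hmem t ht⟩ : N) = 1 := Subtype.ext (by simp)
        simp only [φ, dif_neg ht, this, map_one, Module.End.one_apply]
      exact Prod.ext e1 e2
  let E1 := LinearEquiv.ofBijective ev evb
  let E2 : (Quaternion ℝ × Quaternion ℝ) ≃ₗ[ℝ] (Fin 8 → ℝ) :=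
    LinearEquiv.ofFinrankEq _ _ (by simp [Quaternion.finrank_eq_four])
  let E := E1.trans E2
  refine ⟨{ toFun := fun g => E.toLinearMap ∘ₗ τ g ∘ₗ E.symm.toLinearMap
            map_one' := by apply LinearMap.ext; intro x; simp
            map_mul' := fun g h => by apply LinearMap.ext; intro x; simp }, ?_⟩
  intro g hg v hv
  have hv' : E (τ g (E.symm v)) = v := hv
  have := free g hg (E.symm v) (by rw [← E.symm_apply_apply (τ g (E.symm v)), hv'])
  simpa using this
end

section
/- Let G be a finite group of order 240 having exactly one element of order 2 and possessing a normal subgroup N isomorphic to SL(2,5) (these conditions characterize the non-split extension SL(2,5).C_2). Then N is the unique subgroup of G of index 2; equivalently, the intersection of all subgroups of G of index at most 2 equals N. -/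
/-- The cardinality of SL(2,5). -/
theorem aux_card : Nat.card (Matrix.SpecialLinearGroup (Fin 2) (ZMod 5)) = 120 := by
  have e : Matrix.SpecialLinearGroup (Fin 2) (ZMod 5) ≃
      {p : ZMod 5 × ZMod 5 × ZMod 5 × ZMod 5 // p.1 * p.2.2.2 - p.2.1 * p.2.2.1 = 1} :=
    { toFun := fun A => ⟨(A.1 0 0, A.1 0 1, A.1 1 0, A.1 1 1), by
        have := A.2
        rw [Matrix.det_fin_two] at this
        exact this⟩
      invFun := fun p => ⟨!![p.1.1, p.1.2.1; p.1.2.2.1, p.1.2.2.2], by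
        rw [Matrix.det_fin_two]
        exact p.2⟩
      left_inv := fun A => by
        ext i j
        fin_cases i <;> fin_cases j <;> rfl
      right_inv := fun p => rfl }
  rw [Nat.card_congr e, Nat.card_eq_fintype_card]
  decide +kernel

/-- Upper transvection. -/
def auxU (x : ZMod 5) : Matrix.SpecialLinearGroup (Fin 2) (ZMod 5) :=
  ⟨!![1, x; 0, 1], by simp [Matrix.det_fin_two]⟩

/-- Lower transvection. -/
def auxL (x : ZMod 5) : Matrix.SpecialLinearGroup (Fin 2) (ZMod 5) :=
  ⟨!![1, 0; x, 1], by simp [Matrix.det_fin_two]⟩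

theorem auxU_val (x : ZMod 5) : (auxU x).1 = !![1, x; 0, 1] := rfl

theorem auxL_val (x : ZMod 5) : (auxL x).1 = !![1, 0; x, 1] := rfl

theorem aux_mul (A B : Matrix.SpecialLinearGroup (Fin 2) (ZMod 5)) :
    (A * B).1 = A.1 * B.1 := rfl

theorem auxU_sq (x : ZMod 5) : auxU (3 * x) ^ 2 = auxU x := by
  revert x; decide +kernel

theorem auxL_sq (x : ZMod 5) : auxL (3 * x) ^ 2 = auxL x := by
  revert x; decide +kernel

theorem aux_lin (a b c d : ZMod 5) (h : a * d - b * c = 1) (hc : c ≠ 0) :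
    1 + (a - 1) * c⁻¹ * c = a ∧
    (1 + (a - 1) * c⁻¹ * c) * ((d - 1) * c⁻¹) + (a - 1) * c⁻¹ = b ∧
    c * ((d - 1) * c⁻¹) + 1 = d := by
  revert a b c d; decide +kernel

theorem aux_gen (A : Matrix.SpecialLinearGroup (Fin 2) (ZMod 5)) (hc : A.1 1 0 ≠ 0) :
    A = auxU ((A.1 0 0 - 1) * (A.1 1 0)⁻¹) * auxL (A.1 1 0) *
      auxU ((A.1 1 1 - 1) * (A.1 1 0)⁻¹) := by
  have hd := A.2
  rw [Matrix.det_fin_two] at hd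
  obtain ⟨h1, h2, h3⟩ := aux_lin _ _ _ _ hd hc
  ext i j
  rw [aux_mul, aux_mul, auxU_val, auxL_val, auxU_val]
  fin_cases i <;> fin_cases j <;>
    simp [Matrix.mul_apply, Fin.sum_univ_two]
  · exact h1.symm
  · exact h2.symm
  · exact h3.symm

/-- A subgroup of SL(2,5) containing all squares is everything. -/
theorem aux_top (K : Subgroup (Matrix.SpecialLinearGroup (Fin 2) (ZMod 5)))
    (hK : ∀ x, x ^ 2 ∈ K) : K = ⊤ := by
  have hU : ∀ x, auxU x ∈ K := fun x => auxU_sq x ▸ hK _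
  have hL : ∀ x, auxL x ∈ K := fun x => auxL_sq x ▸ hK _
  have key : ∀ A : Matrix.SpecialLinearGroup (Fin 2) (ZMod 5), A.1 1 0 ≠ 0 → A ∈ K := by
    intro A hA
    rw [aux_gen A hA]
    exact K.mul_mem (K.mul_mem (hU _) (hL _)) (hU _)
  rw [eq_top_iff]
  intro A _
  by_cases hA : A.1 1 0 = 0
  · have h : A * auxL 1 ∈ K := by
      apply key
      have hd := A.2
      rw [Matrix.det_fin_two, hA] at hd
      have : (A * auxL 1).1 1 0 = A.1 1 1 := by
        rw [aux_mul, auxL_val]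
        simp [Matrix.mul_apply, Fin.sum_univ_two, hA]
      rw [this]
      intro h0
      rw [h0] at hd
      revert hd
      rw [mul_zero, mul_zero, sub_zero]
      decide
    exact (K.mul_mem_cancel_right (hL 1)).1 h
  · exact key A hA

/-- If `G` has order 240, exactly one element of order 2, and a normal subgroup `N`
isomorphic to `SL(2,5)` (i.e. `G` is the non-split extension `SL(2,5).C₂`), then `N`
is the unique subgroup of `G` of index 2; equivalently, the intersection of all
subgroups of `G` of index at most 2 equals `N`. -/
theorem stmt14 {G : Type*} [Group G] [Finite G]
    (hcard : Nat.card G = 240)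
    (huniq : ∃! g : G, orderOf g = 2)
    (N : Subgroup G) (hN : N.Normal)
    (hiso : Nonempty (N ≃* Matrix.SpecialLinearGroup (Fin 2) (ZMod 5))) :
    (∀ H : Subgroup G, H.index = 2 ↔ H = N) ∧
    (⨅ H ∈ {H : Subgroup G | H.index ≤ 2}, H) = N := by
  obtain ⟨e⟩ := hiso
  have hNc : Nat.card N = 120 := by rw [Nat.card_congr e.toEquiv, aux_card]
  have hNi : N.index = 2 := by
    have := N.card_mul_index
    rw [hNc, hcard] at this
    omega
  have hle : ∀ H : Subgroup G, H.index = 2 → N ≤ H := by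
    intro H hH n hn
    have ht := aux_top (H.comap (N.subtype.comp e.symm.toMonoidHom)) (by
      intro x
      rw [Subgroup.mem_comap, map_pow]
      exact Subgroup.sq_mem_of_index_two hH _)
    have hm : e ⟨n, hn⟩ ∈ H.comap (N.subtype.comp e.symm.toMonoidHom) := by
      rw [ht]; trivial
    rw [Subgroup.mem_comap] at hm
    simpa using hm
  have huni : ∀ H : Subgroup G, H.index = 2 ↔ H = N := by
    intro H
    constructor
    · intro hH
      refine (Subgroup.eq_of_le_of_card_ge (hle H hH) ?_).symm
      have := H.card_mul_index
      rw [hH, hcard] at this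
      omega
    · rintro rfl; exact hNi
  refine ⟨huni, le_antisymm (iInf₂_le N (by simp [hNi])) (le_iInf₂ ?_)⟩
  intro H hH
  have hH2 : H.index ≤ 2 := hH
  have h0 : H.index ≠ 0 := Subgroup.index_ne_zero_of_finite
  obtain h | h : H.index = 1 ∨ H.index = 2 := by omega
  · rw [Subgroup.index_eq_one.1 h]; exact le_top
  · exact hle H h
end
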